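/- arXiv:1501.05046 — 2 statements merged into one kernel-verified Lean document; each statement's English description precedes it below -/
import Mathlib

section
/- Let Γ be a vertex-primitive digraph on a finite set Ω, regular of valency d, and suppose Γ_1 ≠ ∅ (i.e. there exist vertices u ≠ v with |Γ(u) ∩ Γ(v)| = d − 1). Then one of the following holds: (1) Γ = Ω* (the diagonal); (2) Γ = (Ω × Ω) \ Ω* (the complete graph on Ω); or (3) |Ω| = p is prime, d ≥ 1, and there is a bijection φ : Ω → ℤ/pℤ and x ∈ ℤ/pℤ with (u,v) ∈ Γ ↔ φ(v) − φ(u) ∈ {x+1, …, x+d} (i.e. Γ ≅ Δ_{p,x,d}). -/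
/-- The neighbourhood of a vertex `v` in a digraph `Γ ⊆ Ω × Ω`. -/
def nbhd {Ω : Type*} (Γ : Set (Ω × Ω)) (v : Ω) : Set Ω := {u | (v, u) ∈ Γ}

/-- The automorphism group of a digraph `Γ`, as a subgroup of `Equiv.Perm Ω`. -/
def digraphAut {Ω : Type*} (Γ : Set (Ω × Ω)) : Subgroup (Equiv.Perm Ω) where
  carrier := {g | ∀ u v : Ω, (u, v) ∈ Γ ↔ (g u, g v) ∈ Γ}
  one_mem' := fun _ _ => Iff.rfl
  mul_mem' := fun ha hb u v => (hb u v).trans (ha _ _)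
  inv_mem' := by
    intro a ha u v
    simpa using (ha (a⁻¹ u) (a⁻¹ v)).symm

/-- A permutation group `G ≤ Sym(Ω)` is primitive if it is transitive and
every block is trivial (a subsingleton or the whole set). -/
def IsPrimitiveSubgroup {Ω : Type*} (G : Subgroup (Equiv.Perm Ω)) : Prop :=
  MulAction.IsPretransitive G Ω ∧
    ∀ B : Set Ω, MulAction.IsBlock G B → B.Subsingleton ∨ B = Set.univ

/-- A digraph is vertex-primitive if its automorphism group is primitive. -/
def VertexPrimitive {Ω : Type*} (Γ : Set (Ω × Ω)) : Prop :=
  IsPrimitiveSubgroup (digraphAut Γ)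

/-- `Γ_i`: the pairs of vertices whose neighbourhoods meet in exactly `d - i` points. -/
def GammaI {Ω : Type*} (Γ : Set (Ω × Ω)) (d i : ℕ) : Set (Ω × Ω) :=
  {p | (nbhd Γ p.1 ∩ nbhd Γ p.2).ncard + i = d}

section Primitive

variable {Ω : Type*} {G : Subgroup (Equiv.Perm Ω)}

/-- A nontrivial equivalence relation invariant under a primitive group is universal. -/
theorem IsPrimitiveSubgroup.rel_of_ne (hG : IsPrimitiveSubgroup G) (s : Setoid Ω)
    (hs : ∀ g ∈ G, ∀ a b, s a b → s (g a) (g b)) {a b : Ω} (hab : a ≠ b) (h : s a b) (x y : Ω) :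
    s x y := by
  have hB : MulAction.IsBlock G {y | s a y} := by
    rw [MulAction.isBlock_iff_smul_eq_or_disjoint]
    intro g
    by_cases hg : s a (g.1 a)
    · left
      ext z
      rw [Set.mem_smul_set_iff_inv_smul_mem]
      have e : g.1 ((g⁻¹ • z : Ω)) = z := smul_inv_smul g z
      constructor
      · intro hz
        have := hs g.1 g.2 _ _ hz
        rw [e] at this
        exact s.trans hg this
      · intro hz
        have := hs g⁻¹.1 g⁻¹.2 _ _ (s.trans (s.symm hg) hz)
        have e2 : g⁻¹.1 (g.1 a) = a := inv_smul_smul g a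
        rw [e2] at this
        exact this
    · right
      rw [Set.disjoint_left]
      intro z hz hz'
      rw [Set.mem_smul_set_iff_inv_smul_mem] at hz
      have e : g.1 ((g⁻¹ • z : Ω)) = z := smul_inv_smul g z
      have := hs g.1 g.2 _ _ hz
      rw [e] at this
      exact hg (s.trans hz' (s.symm this))
  rcases hG.2 _ hB with h' | h'
  · exact absurd (h' (s.refl a) h) hab
  · have hx : x ∈ {y | s a y} := h' ▸ Set.mem_univ x
    have hy : y ∈ {y | s a y} := h' ▸ Set.mem_univ y
    exact s.trans (s.symm hx) hy

/-- A nontrivial symmetric relation invariant under a primitive group is connected. -/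
theorem IsPrimitiveSubgroup.forall_of_closed (hG : IsPrimitiveSubgroup G) {R : Ω → Ω → Prop}
    (hsymm : ∀ a b, R a b → R b a) (hR : ∀ g ∈ G, ∀ a b, R a b → R (g a) (g b))
    {a b : Ω} (hab : a ≠ b) (h : R a b) {P : Ω → Prop} (hP : ∀ x y, R x y → P x → P y)
    {x : Ω} (hx : P x) (y : Ω) : P y := by
  have key := hG.rel_of_ne (Relation.EqvGen.setoid R) (by
    intro g hg a b hab
    induction hab with
    | rel x y h => exact .rel _ _ (hR g hg _ _ h)
    | refl x => exact .refl _
    | symm x y _ ih => exact .symm _ _ ih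
    | trans x y z _ _ ih₁ ih₂ => exact .trans _ _ _ ih₁ ih₂) hab (.rel _ _ h) x y
  have : P x ↔ P y := by
    change Relation.EqvGen R x y at key
    clear hx
    induction key with
    | rel x y h => exact ⟨hP _ _ h, hP _ _ (hsymm _ _ h)⟩
    | refl x => rfl
    | symm x y _ ih => exact ih.symm
    | trans x y z _ _ ih₁ ih₂ => exact ih₁.trans ih₂
  exact this.1 hx

theorem IsPrimitiveSubgroup.exists_apply_eq (hG : IsPrimitiveSubgroup G) (a b : Ω) :
    ∃ g ∈ G, g a = b := by
  obtain ⟨g, hg⟩ := hG.1.exists_smul_eq a b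
  exact ⟨g.1, g.2, hg⟩

/-- A primitive group normalising the cyclic group generated by a nontrivial permutation, and
acting on it by inversions, acts on `ZMod n` by maps of the form `v ↦ c ± v`. -/
theorem IsPrimitiveSubgroup.exists_equiv_zmod [Finite Ω] (hG : IsPrimitiveSubgroup G)
    {ρ : Equiv.Perm Ω} (hρ : ρ ≠ 1) (h : ∀ g ∈ G, SemiconjBy g ρ ρ ∨ SemiconjBy g ρ ρ⁻¹) :
    ∃ n : ℕ, ∃ φ : Ω ≃ ZMod n, ∀ g ∈ G, ∃ c,
      (∀ v, φ (g v) = φ v + c) ∨ (∀ v, φ (g v) = c - φ v) := by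
  obtain ⟨b, hb⟩ : ∃ b, ρ b ≠ b := by
    by_contra! hcon
    exact hρ (Equiv.ext hcon)
  have hall := hG.rel_of_ne (Equiv.Perm.SameCycle.setoid ρ) (by
    rintro g hg x y ⟨k, rfl⟩
    rcases h g hg with hc | hc
    · refine ⟨k, ?_⟩
      have := (hc.zpow_right k).eq
      exact (DFunLike.congr_fun this x).symm
    · refine ⟨-k, ?_⟩
      have := (hc.zpow_right k).eq
      rw [inv_zpow'] at this
      exact (DFunLike.congr_fun this x).symm) hb.symm ⟨1, by simp⟩ b
  have horb : ∀ x, x ∈ MulAction.orbit (Subgroup.zpowers ρ) b := by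
    intro x
    obtain ⟨k, hk⟩ := hall x
    exact ⟨⟨ρ ^ k, k, rfl⟩, hk⟩
  let φ : Ω ≃ ZMod (Function.minimalPeriod (ρ • ·) b) :=
    (Equiv.subtypeUnivEquiv horb).symm.trans (MulAction.orbitZPowersEquiv ρ b)
  have hφ : ∀ k : ℤ, φ ((ρ ^ k) b) = k := by
    intro k
    rw [← Equiv.eq_symm_apply]
    simp only [φ, Equiv.symm_trans_apply, Equiv.symm_symm]
    rw [MulAction.orbitZPowersEquiv_symm_apply']
    rfl
  refine ⟨_, φ, fun g hg => ?_⟩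
  obtain ⟨c, hc⟩ := hall (g b)
  refine ⟨c, ?_⟩
  rcases h g hg with hs | hs
  · left
    intro v
    obtain ⟨k, rfl⟩ := hall v
    have := DFunLike.congr_fun (hs.zpow_right k).eq b
    simp only [Equiv.Perm.mul_apply] at this
    rw [this, ← hc, ← Equiv.Perm.mul_apply, ← zpow_add, hφ, hφ]
    push_cast; ring
  · right
    intro v
    obtain ⟨k, rfl⟩ := hall v
    have := DFunLike.congr_fun (hs.zpow_right k).eq b
    simp only [Equiv.Perm.mul_apply] at this
    rw [this, ← hc, ← Equiv.Perm.mul_apply, inv_zpow', ← zpow_add, hφ, hφ]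
    push_cast; ring

/-- A primitive group acting on `ZMod n` by maps `v ↦ c ± v` has prime degree
and contains all translations. -/
theorem IsPrimitiveSubgroup.prime_and_translations [Finite Ω] [Nontrivial Ω]
    (hG : IsPrimitiveSubgroup G) {n : ℕ} (φ : Ω ≃ ZMod n)
    (h : ∀ g ∈ G, ∃ c, (∀ v, φ (g v) = φ v + c) ∨ (∀ v, φ (g v) = c - φ v)) :
    n.Prime ∧ ∀ c, ∃ g ∈ G, ∀ v, φ (g v) = φ v + c := by
  have : Finite (ZMod n) := Finite.of_equiv _ φ
  have : Nontrivial (ZMod n) := φ.symm.nontrivial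
  have hK : ∀ K : AddSubgroup (ZMod n), K = ⊥ ∨ K = ⊤ := by
    intro K
    refine or_iff_not_imp_left.2 fun hK => ?_
    obtain ⟨⟨k, hk⟩, hk0⟩ := AddSubgroup.ne_bot_iff_exists_ne_zero.1 hK
    replace hk0 : k ≠ 0 := fun h => hk0 (Subtype.ext h)
    have := hG.rel_of_ne ((QuotientAddGroup.leftRel K).comap φ) (by
      intro g hg a b hab
      simp only [Setoid.comap_rel, QuotientAddGroup.leftRel_apply] at hab ⊢
      obtain ⟨c, hc | hc⟩ := h g hg
      · rw [hc, hc]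
        convert hab using 1
        ring
      · rw [hc, hc]
        convert K.neg_mem hab using 1
        ring) (a := φ.symm 0) (b := φ.symm k) (by simpa using hk0.symm)
        (by simpa [Setoid.comap_rel, QuotientAddGroup.leftRel_apply] using hk)
    rw [eq_top_iff]
    intro x _
    have := this (φ.symm 0) (φ.symm x)
    simpa [Setoid.comap_rel, QuotientAddGroup.leftRel_apply] using this
  have hsimple : IsSimpleAddGroup (ZMod n) := ⟨fun K _ => hK K⟩
  refine ⟨by simpa using IsSimpleAddGroup.prime_card (α := ZMod n), ?_⟩
  let K : AddSubgroup (ZMod n) :=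
    { carrier := {c | ∃ g ∈ G, ∀ v, φ (g v) = φ v + c}
      zero_mem' := ⟨1, G.one_mem, by simp⟩
      add_mem' := by
        rintro a b ⟨g, hg, hga⟩ ⟨k, hk, hkb⟩
        exact ⟨g * k, G.mul_mem hg hk, fun v => by
          rw [Equiv.Perm.mul_apply, hga, hkb]; ring⟩
      neg_mem' := by
        rintro a ⟨g, hg, hga⟩
        refine ⟨g⁻¹, G.inv_mem hg, fun v => ?_⟩
        have := hga (g⁻¹ v)
        rw [← Equiv.Perm.mul_apply, mul_inv_cancel, Equiv.Perm.one_apply] at this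
        rw [this]; ring }
  have hne : ∃ c ∈ K, c ≠ 0 := by
    obtain ⟨g, hg, hg1⟩ := hG.exists_apply_eq (φ.symm 0) (φ.symm 1)
    obtain ⟨k, hk, hk1⟩ := hG.exists_apply_eq (φ.symm 0) (φ.symm 2)
    obtain ⟨c, hc⟩ := h g hg
    obtain ⟨e, he⟩ := h k hk
    have hc1 : c = 1 := by
      rcases hc with hc | hc <;> simpa [hg1] using (hc (φ.symm 0)).symm
    have he2 : e = 2 := by
      rcases he with hc | hc <;> simpa [hk1] using (hc (φ.symm 0)).symm
    subst hc1 he2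
    rcases hc with hc | hc
    · exact ⟨1, ⟨g, hg, hc⟩, one_ne_zero⟩
    by_cases h2 : (2 : ZMod n) = 0
    · refine ⟨1, ⟨g, hg, fun v => ?_⟩, one_ne_zero⟩
      rw [hc]
      linear_combination (- φ v) * h2
    rcases he with he | he
    · exact ⟨2, ⟨k, hk, he⟩, h2⟩
    · refine ⟨1, ⟨k * g, G.mul_mem hk hg, fun v => ?_⟩, one_ne_zero⟩
      rw [Equiv.Perm.mul_apply, he, hc]; ring
  obtain ⟨c, hc, hc0⟩ := hne
  have hKt : K = ⊤ := (hK K).resolve_left fun hb => hc0 (by simpa [hb] using hc)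
  intro c
  have : c ∈ K := hKt ▸ AddSubgroup.mem_top c
  exact this

end Primitive

/-- A subset of `ZMod p` with a unique element whose predecessor lies outside it is an interval. -/
theorem mem_iff_of_unique_start {p : ℕ} [NeZero p] (S : Finset (ZMod p)) {a : ZMod p}
    (ha : ∀ s, s ∈ S ∧ s - 1 ∉ S ↔ s = a) (s : ZMod p) :
    s ∈ S ↔ ∃ k : ℕ, 1 ≤ k ∧ k ≤ S.card ∧ s = (a - 1) + k := by
  set T : Finset ℕ := (Finset.range p).filter fun j => a + (j : ZMod p) ∈ S with hT
  have hdown : ∀ j, j + 1 ∈ T → j ∈ T := by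
    intro j hj
    simp only [hT, Finset.mem_filter, Finset.mem_range] at hj ⊢
    refine ⟨by omega, ?_⟩
    by_contra hcon
    have h1 := (ha (a + ((j + 1 : ℕ) : ZMod p))).1 ⟨hj.2, by
      convert hcon using 2; push_cast; ring⟩
    rw [add_eq_left, ZMod.natCast_eq_zero_iff] at h1
    exact absurd (Nat.le_of_dvd (by omega) h1) (by omega)
  have hdown' : ∀ i j, i ≤ j → j ∈ T → i ∈ T := by
    intro i j hij
    induction hij with
    | refl => exact id
    | step _ ih => exact fun h => ih (hdown _ h)
  have hcard : T.card = S.card := by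
    refine Finset.card_bij (fun j _ => a + (j : ZMod p)) ?_ ?_ ?_
    · intro j hj
      exact (Finset.mem_filter.1 hj).2
    · intro i hi j hj hij
      simp only [hT, Finset.mem_filter, Finset.mem_range] at hi hj
      have := (ZMod.natCast_eq_natCast_iff' i j p).1 (add_left_cancel hij)
      rwa [Nat.mod_eq_of_lt hi.1, Nat.mod_eq_of_lt hj.1] at this
    · intro b hb
      refine ⟨(b - a).val, ?_, ?_⟩
      · simp [hT, ZMod.val_lt, hb]
      · simp
  have hmem : ∀ j, j ∈ T ↔ j < S.card := by
    intro j
    rw [← hcard]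
    constructor
    · intro hj
      have : Finset.range (j + 1) ⊆ T := fun i hi =>
        hdown' i j (Nat.lt_succ_iff.1 (Finset.mem_range.1 hi)) hj
      simpa using Finset.card_le_card this
    · intro hj
      by_contra hcon
      have : T ⊆ Finset.range j := fun i hi => by
        rw [Finset.mem_range]
        by_contra hij
        exact hcon (hdown' j i (by omega) hi)
      have := Finset.card_le_card this
      rw [Finset.card_range] at this
      omega
  constructor
  · intro hs
    have : (s - a).val ∈ T := by simp [hT, ZMod.val_lt, hs]
    refine ⟨(s - a).val + 1, by omega, (hmem _).1 this, ?_⟩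
    push_cast
    rw [ZMod.natCast_zmod_val]
    ring
  · rintro ⟨k, hk1, hk, rfl⟩
    have : k - 1 ∈ T := (hmem _).2 (by omega)
    have := (Finset.mem_filter.1 this).2
    convert this using 1
    push_cast [hk1]
    ring

section EdgeCut

variable {Ω : Type*} [Fintype Ω] [DecidableEq Ω] (H : Ω → Ω → Prop) [DecidableRel H]

/-- The arcs of the relation `H` leaving the vertex set `X`. -/
def edgeCut (X : Finset Ω) : Finset (Ω × Ω) :=
  Finset.univ.filter fun e => H e.1 e.2 ∧ e.1 ∈ X ∧ e.2 ∉ X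

variable {H}

theorem card_edgeCut_compl (hH : ∀ a b, H a b → H b a) (X : Finset Ω) :
    (edgeCut H Xᶜ).card = (edgeCut H X).card := by
  refine Finset.card_bij (fun e _ => e.swap) ?_ ?_ ?_
  · rintro ⟨a, b⟩ h
    simp only [edgeCut, Finset.mem_filter, Finset.mem_univ, true_and, Finset.mem_compl,
      not_not, Prod.swap_prod_mk] at h ⊢
    exact ⟨hH _ _ h.1, h.2.2, h.2.1⟩
  · intro a _ b _ h
    exact Prod.swap_injective h
  · rintro ⟨a, b⟩ h
    refine ⟨(b, a), ?_, rfl⟩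
    simp only [edgeCut, Finset.mem_filter, Finset.mem_univ, true_and, Finset.mem_compl,
      not_not] at h ⊢
    exact ⟨hH _ _ h.1, h.2.2, h.2.1⟩

theorem card_edgeCut_inter_add_union (X Y : Finset Ω) :
    (edgeCut H (X ∩ Y)).card + (edgeCut H (X ∪ Y)).card ≤
      (edgeCut H X).card + (edgeCut H Y).card := by
  have h₁ : edgeCut H (X ∩ Y) ∪ edgeCut H (X ∪ Y) ⊆ edgeCut H X ∪ edgeCut H Y := by
    intro e
    simp only [edgeCut, Finset.mem_union, Finset.mem_filter, Finset.mem_univ, true_and,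
      Finset.mem_inter]
    tauto
  have h₂ : edgeCut H (X ∩ Y) ∩ edgeCut H (X ∪ Y) ⊆ edgeCut H X ∩ edgeCut H Y := by
    intro e
    simp only [edgeCut, Finset.mem_union, Finset.mem_filter, Finset.mem_univ, true_and,
      Finset.mem_inter]
    tauto
  rw [← Finset.card_union_add_card_inter, ← Finset.card_union_add_card_inter (edgeCut H X)]
  exact add_le_add (Finset.card_le_card h₁) (Finset.card_le_card h₂)

theorem card_edgeCut_sdiff_add_sdiff (hH : ∀ a b, H a b → H b a) (X Y : Finset Ω) :
    (edgeCut H (X \ Y)).card + (edgeCut H (Y \ X)).card ≤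
      (edgeCut H X).card + (edgeCut H Y).card := by
  have h := card_edgeCut_inter_add_union (H := H) X Yᶜ
  rw [← Finset.sdiff_eq_inter_compl, card_edgeCut_compl hH] at h
  have e : X ∪ Yᶜ = (Y \ X)ᶜ := by
    ext x; simp only [Finset.mem_union, Finset.mem_compl, Finset.mem_sdiff]; tauto
  rwa [e, card_edgeCut_compl hH] at h

theorem card_edgeCut_map {g : Equiv.Perm Ω} (hg : ∀ a b, H a b ↔ H (g a) (g b))
    (X : Finset Ω) : (edgeCut H (X.map g.toEmbedding)).card = (edgeCut H X).card := by
  symm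
  refine Finset.card_bij (fun e _ => (g e.1, g e.2)) ?_ ?_ ?_
  · rintro ⟨a, b⟩ h
    simpa [edgeCut, ← hg] using h
  · rintro ⟨a, b⟩ _ ⟨c, d⟩ _ h
    simpa using h
  · rintro ⟨a, b⟩ h
    refine ⟨(g.symm a, g.symm b), ?_, by simp⟩
    have := hg (g.symm a) (g.symm b)
    simp only [edgeCut, Finset.mem_filter, Finset.mem_univ, true_and,
      Finset.mem_map_equiv, Equiv.apply_symm_apply] at h this ⊢
    exact ⟨this.2 h.1, h.2⟩

theorem card_edgeCut_singleton (hirr : ∀ a, ¬ H a a) (a : Ω) :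
    (edgeCut H {a}).card = (Finset.univ.filter (H a)).card := by
  symm
  refine Finset.card_bij (fun b _ => (a, b)) ?_ ?_ ?_
  · intro b hb
    have : H a b := by simpa using hb
    simp only [edgeCut, Finset.mem_filter, Finset.mem_univ, true_and, Finset.mem_singleton]
    refine ⟨this, ?_⟩
    rintro rfl
    exact hirr _ this
  · intro b _ c _ h
    exact (Prod.ext_iff.1 h).2
  · rintro ⟨x, b⟩ h
    simp only [edgeCut, Finset.mem_filter, Finset.mem_univ, true_and,
      Finset.mem_singleton] at h
    obtain ⟨h, rfl, -⟩ := h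
    exact ⟨b, by simpa using h, rfl⟩

theorem two_mul_le_card_edgeCut_pair {k : ℕ} (hk : ∀ a, (edgeCut H {a}).card = k)
    {a b : Ω} (hab : a ≠ b) :
    2 * k ≤ (edgeCut H {a, b}).card + 2 := by
  have hd : Disjoint (edgeCut H {a}) (edgeCut H {b}) := by
    rw [Finset.disjoint_left]
    intro e h₁ h₂
    simp only [edgeCut, Finset.mem_filter, Finset.mem_univ, true_and,
      Finset.mem_singleton] at h₁ h₂
    exact hab (h₁.2.1.symm.trans h₂.2.1)
  have hsub : edgeCut H {a} ∪ edgeCut H {b} ⊆ edgeCut H {a, b} ∪ {(a, b), (b, a)} := by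
    rintro ⟨x, y⟩
    simp only [edgeCut, Finset.mem_filter, Finset.mem_univ, true_and, Finset.mem_insert,
      Finset.mem_singleton, Finset.mem_union, Prod.mk.injEq]
    tauto
  have := (Finset.card_le_card hsub).trans (Finset.card_union_le _ _)
  rw [Finset.card_union_of_disjoint hd, hk, hk] at this
  have h2 : ({(a, b), (b, a)} : Finset (Ω × Ω)).card ≤ 2 := Finset.card_le_two
  omega

open scoped Pointwise in
/-- In a vertex-primitive graph of valency `k ≥ 3`, only the stars of vertices are edge cuts with
at most `k` edges. -/
theorem IsPrimitiveSubgroup.card_eq_one_of_card_edgeCut_le {G : Subgroup (Equiv.Perm Ω)}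
    (hG : IsPrimitiveSubgroup G) (hH : ∀ a b, H a b → H b a)
    (hGH : ∀ g ∈ G, ∀ a b, H a b ↔ H (g a) (g b))
    {k : ℕ} (hk : ∀ a, (edgeCut H {a}).card = k) (hk3 : 3 ≤ k) {X : Finset Ω}
    (hX : X.Nonempty) (hX' : Xᶜ.Nonempty) (hXk : (edgeCut H X).card ≤ k) :
    X.card = 1 ∨ Xᶜ.card = 1 := by
  by_contra! hcon
  have hX1 := hX.card_pos
  have hX2 := hX'.card_pos
  set n := Fintype.card Ω with hn
  have hcompl : ∀ Y : Finset Ω, Y.card + Yᶜ.card = n := Finset.card_add_card_compl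
  set F : Finset (Finset Ω) := Finset.univ.filter fun Y =>
    2 ≤ Y.card ∧ 2 ≤ Yᶜ.card ∧ (edgeCut H Y).card ≤ k with hF
  have hFX : F.Nonempty := ⟨X, by
    simp only [hF, Finset.mem_filter, Finset.mem_univ, true_and]; omega⟩
  obtain ⟨Z, hZF, hZ⟩ := F.exists_min_image
    (fun Y => toLex ((edgeCut H Y).card, Y.card)) hFX
  simp only [hF, Finset.mem_filter, Finset.mem_univ, true_and] at hZF hZ
  have hmin : ∀ Y : Finset Ω, 2 ≤ Y.card → Y.card + 2 ≤ n →
      (edgeCut H Y).card ≤ (edgeCut H Z).card →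
      (edgeCut H Y).card = (edgeCut H Z).card ∧ Z.card ≤ Y.card := by
    intro Y h₁ h₂ h₃
    have := hZ Y ⟨h₁, by have := hcompl Y; omega, by omega⟩
    rw [Prod.Lex.toLex_le_toLex] at this
    simp only at this
    omega
  obtain ⟨hZ2, hZ2', hZk⟩ := hZF
  have hZc := hcompl Z
  have hhalf : Z.card ≤ Zᶜ.card :=
    (hmin Zᶜ hZ2' (by omega) (card_edgeCut_compl hH Z).le).2
  have hnb : ¬ MulAction.IsBlock G (Z : Set Ω) := by
    intro hb
    rcases hG.2 _ hb with h | h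
    · have := Finset.card_le_one.2 fun a ha b hb => h ha hb
      omega
    · have : Z = Finset.univ := by exact_mod_cast h
      rw [this] at hZ2'
      simp at hZ2'
  rw [MulAction.isBlock_iff_smul_eq_or_disjoint] at hnb
  push Not at hnb
  obtain ⟨g, hne, hnd⟩ := hnb
  set Y : Finset Ω := Z.map g.1.toEmbedding with hY
  have hYset : (g • (Z : Set Ω)) = (Y : Set Ω) := by
    rw [hY, Finset.coe_map]; rfl
  rw [hYset] at hne hnd
  rw [Finset.disjoint_coe, Finset.disjoint_iff_inter_eq_empty, ← ne_eq,
    ← Finset.nonempty_iff_ne_empty] at hnd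
  have hYc : Y.card = Z.card := Finset.card_map _
  have hYcut : (edgeCut H Y).card = (edgeCut H Z).card := card_edgeCut_map (hGH g.1 g.2) Z
  have hne' : Y ≠ Z := fun h => hne (by rw [h])
  have hsub := card_edgeCut_inter_add_union (H := H) Y Z
  have hpos := card_edgeCut_sdiff_add_sdiff hH Y Z
  have hui := Finset.card_union_add_card_inter Y Z
  have hdi := Finset.card_sdiff_add_card_inter Y Z
  have hdi' := Finset.card_sdiff_add_card_inter Z Y
  rw [Finset.inter_comm Z Y] at hdi'
  have hlt : (Y ∩ Z).card < Z.card := by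
    refine Finset.card_lt_card (Finset.ssubset_iff_subset_ne.2 ⟨Finset.inter_subset_right, ?_⟩)
    intro h
    exact hne' (Finset.eq_of_subset_of_card_le (Finset.inter_eq_right.1 h) hYc.le).symm
  have hpos1 := hnd.card_pos
  by_cases h1 : 2 ≤ (Y ∩ Z).card
  · have h₁ := hmin (Y ∩ Z) h1 (by omega)
    have h₂ := hmin (Y ∪ Z) (by omega) (by omega)
    omega
  · by_cases h2 : Z.card = 2
    · obtain ⟨a, b, hne, hab⟩ := Finset.card_eq_two.1 h2
      have := two_mul_le_card_edgeCut_pair hk hne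
      rw [← hab] at this
      omega
    · have h₁ := hmin (Y \ Z) (by omega) (by omega)
      have h₂ := hmin (Z \ Y) (by omega) (by omega)
      omega

end EdgeCut

section Digraph

variable {Ω : Type*} {Γ : Set (Ω × Ω)} {d : ℕ}

theorem gammaI_symm {i : ℕ} {u v : Ω} (h : (u, v) ∈ GammaI Γ d i) : (v, u) ∈ GammaI Γ d i := by
  simpa [GammaI, Set.inter_comm] using h

theorem image_nbhd {g : Equiv.Perm Ω} (hg : g ∈ digraphAut Γ) (v : Ω) :
    g '' nbhd Γ v = nbhd Γ (g v) := by
  ext x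
  rw [Equiv.image_eq_preimage_symm, Set.mem_preimage]
  have := hg v (g.symm x)
  rw [Equiv.apply_symm_apply] at this
  exact this

theorem gammaI_iff_of_mem_digraphAut {g : Equiv.Perm Ω} (hg : g ∈ digraphAut Γ) {i : ℕ}
    (u v : Ω) : (u, v) ∈ GammaI Γ d i ↔ (g u, g v) ∈ GammaI Γ d i := by
  simp only [GammaI, Set.mem_ofPred_eq]
  rw [← image_nbhd hg, ← image_nbhd hg, ← Set.image_inter g.injective,
    Set.ncard_image_of_injective _ g.injective]

theorem exists_nbhd_diff_eq_singleton [Finite Ω] (hreg : ∀ v : Ω, (nbhd Γ v).ncard = d) {u v : Ω}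
    (h : (u, v) ∈ GammaI Γ d 1) : ∃ a, nbhd Γ u \ nbhd Γ v = {a} := by
  rw [← Set.ncard_eq_one]
  have h₁ := Set.ncard_inter_add_ncard_sdiff_eq_ncard (nbhd Γ u) (nbhd Γ v)
  have h₂ : (nbhd Γ u ∩ nbhd Γ v).ncard + 1 = d := h
  rw [hreg] at h₁
  omega

theorem ne_of_mem_gammaI_one [Finite Ω] (hreg : ∀ v : Ω, (nbhd Γ v).ncard = d) {u v : Ω}
    (h : (u, v) ∈ GammaI Γ d 1) : u ≠ v := by
  rintro rfl
  obtain ⟨a, ha⟩ := exists_nbhd_diff_eq_singleton hreg h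
  rw [Set.sdiff_self] at ha
  exact Set.singleton_ne_empty a ha.symm

/-- A vertex-primitive digraph with `Γ_1` nonempty whose automorphisms act on `ZMod n` by maps
`v ↦ c ± v` is some `Δ_{p,x,d}`. -/
theorem exists_zmod_of_dihedral [Fintype Ω] (hprim : VertexPrimitive Γ)
    (hreg : ∀ v : Ω, (nbhd Γ v).ncard = d) {u₀ v₀ : Ω} (h₀ : (u₀, v₀) ∈ GammaI Γ d 1)
    {n : ℕ} (φ : Ω ≃ ZMod n)
    (h : ∀ g ∈ digraphAut Γ, ∃ c, (∀ v, φ (g v) = φ v + c) ∨ (∀ v, φ (g v) = c - φ v)) :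
    ∃ p : ℕ, p.Prime ∧ Fintype.card Ω = p ∧ 1 ≤ d ∧
      ∃ φ : Ω ≃ ZMod p, ∃ x : ZMod p, ∀ u v : Ω,
        ((u, v) ∈ Γ ↔ ∃ k : ℕ, 1 ≤ k ∧ k ≤ d ∧ φ v - φ u = x + (k : ZMod p)) := by
  classical
  have hne := ne_of_mem_gammaI_one hreg h₀
  have : Nontrivial Ω := ⟨u₀, v₀, hne⟩
  obtain ⟨hp, htr⟩ := hprim.prime_and_translations φ h
  have : Fact n.Prime := ⟨hp⟩
  set r := φ v₀ - φ u₀ with hr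
  have hr0 : r ≠ 0 := sub_ne_zero.2 fun h => hne (φ.injective h).symm
  let ψ : Ω ≃ ZMod n := φ.trans (Equiv.mulRight₀ r⁻¹ (inv_ne_zero hr0))
  have hψ : ∀ v, ψ v = φ v * r⁻¹ := fun v => rfl
  have htrψ : ∀ c, ∃ g ∈ digraphAut Γ, ∀ v, ψ (g v) = ψ v + c := by
    intro c
    obtain ⟨g, hg, hgc⟩ := htr (c * r)
    exact ⟨g, hg, fun v => by rw [hψ, hψ, hgc, add_mul, mul_inv_cancel_right₀ hr0]⟩
  have hψ₀ : ψ v₀ = ψ u₀ + 1 := by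
    have : r * r⁻¹ = 1 := mul_inv_cancel₀ hr0
    rw [hr, sub_mul, ← hr] at this
    rw [hψ, hψ]
    linear_combination this
  set S : Finset (ZMod n) :=
    Finset.univ.filter fun s => (u₀, ψ.symm (ψ u₀ + s)) ∈ Γ with hS
  have hΓS : ∀ u v, (u, v) ∈ Γ ↔ ψ v - ψ u ∈ S := by
    intro u v
    obtain ⟨g, hg, hgc⟩ := htrψ (ψ u₀ - ψ u)
    have e₁ : g u = u₀ := ψ.injective (by rw [hgc]; ring)
    have e₂ : g v = ψ.symm (ψ u₀ + (ψ v - ψ u)) := by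
      rw [Equiv.eq_symm_apply, hgc]; ring
    rw [hS, Finset.mem_filter, hg u v, e₁, e₂]
    simp
  have hScard : S.card = d := by
    rw [← hreg u₀, ← Set.ncard_coe_finset]
    refine (Set.ncard_congr (fun v _ => ψ v - ψ u₀) ?_ ?_ ?_).symm
    · intro v hv
      exact (hΓS u₀ v).1 hv
    · intro v w _ _ h
      exact ψ.injective (sub_left_injective h)
    · intro s hs
      exact ⟨ψ.symm (ψ u₀ + s), (hΓS _ _).2 (by simpa using hs), by simp⟩
  obtain ⟨a, ha⟩ := exists_nbhd_diff_eq_singleton hreg h₀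
  have hstart : ∀ s, s ∈ S ∧ s - 1 ∉ S ↔ s = ψ a - ψ u₀ := by
    intro s
    have := Set.ext_iff.1 ha (ψ.symm (ψ u₀ + s))
    simp only [nbhd, Set.mem_sdiff, Set.mem_ofPred_eq, hΓS, hψ₀, Equiv.apply_symm_apply,
      Set.mem_singleton_iff, Equiv.symm_apply_eq, add_sub_cancel_left, add_sub_add_left_eq_sub]
      at this
    rw [this, eq_sub_iff_add_eq, add_comm]
  refine ⟨n, hp, by rw [Fintype.card_congr φ, ZMod.card], ?_, ψ, ψ a - ψ u₀ - 1, fun u v => ?_⟩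
  · have : (nbhd Γ u₀ ∩ nbhd Γ v₀).ncard + 1 = d := h₀
    omega
  · rw [hΓS, mem_iff_of_unique_start S hstart, hScard]

end Digraph

section Rotation

variable {Ω : Type*} {R : Ω → Ω → Prop}

/-- In a connected graph of valency two, there is a rotation. -/
theorem IsPrimitiveSubgroup.exists_rotation [Finite Ω] {G : Subgroup (Equiv.Perm Ω)}
    (hG : IsPrimitiveSubgroup G) (hsymm : ∀ a b, R a b → R b a) (hirr : ∀ a, ¬ R a a)
    (hR : ∀ g ∈ G, ∀ a b, R a b ↔ R (g a) (g b)) {a₀ b₀ : Ω} (h₀ : R a₀ b₀)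
    (hval : ∀ u v, R v u → ∃ w, R v w ∧ w ≠ u ∧ ∀ x, R v x → x = u ∨ x = w) :
    ∃ ρ : Equiv.Perm Ω, ρ ≠ 1 ∧ ∀ g ∈ G, SemiconjBy g ρ ρ ∨ SemiconjBy g ρ ρ⁻¹ := by
  choose other hRo hne ho using hval
  have hou : ∀ u v x y, R v u → R v x → R v y → x ≠ u → y ≠ u → x = y :=
    fun u v x y hu hx hy hxu hyu =>
      ((ho u v hu x hx).resolve_left hxu).trans ((ho u v hu y hy).resolve_left hyu).symm
  let A := {e : Ω × Ω // R e.2 e.1}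
  let f : A → A := fun e => ⟨(e.1.2, other _ _ e.2), hsymm _ _ (hRo _ _ e.2)⟩
  have hf : Function.Injective f := by
    rintro ⟨⟨u, v⟩, h⟩ ⟨⟨u', v'⟩, h'⟩ hh
    obtain ⟨hv, hh⟩ := Prod.ext_iff.1 (Subtype.ext_iff.1 hh)
    simp only [f] at hv hh
    subst hv
    have : u = u' := by
      rcases ho _ _ h' u h with h1 | h1
      · exact h1
      · exact absurd (hh.trans h1.symm) (hne _ _ h)
    subst this
    rfl
  let τ : Equiv.Perm A := Equiv.ofBijective f (Finite.injective_iff_bijective.1 hf)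
  let w : ℤ → Ω := fun k => ((τ ^ k) ⟨(a₀, b₀), hsymm _ _ h₀⟩).1.1
  have hw2 : ∀ k, ((τ ^ k) ⟨(a₀, b₀), hsymm _ _ h₀⟩).1.2 = w (k + 1) := by
    intro k
    simp only [w]
    rw [add_comm, zpow_one_add]
    rfl
  have hwR : ∀ k, R (w (k + 1)) (w k) := by
    intro k
    rw [← hw2]
    exact ((τ ^ k) ⟨(a₀, b₀), hsymm _ _ h₀⟩).2
  have hwo : ∀ k, w (k + 2) = other _ _ (hwR k) := by
    intro k
    have : w (k + 2) = (f ((τ ^ k) ⟨(a₀, b₀), hsymm _ _ h₀⟩)).1.2 := by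
      rw [show k + 2 = (k + 1) + 1 by ring, ← hw2, add_comm, zpow_one_add]
      rfl
    rw [this]
    simp only [f]
    congr 1
    exact hw2 k
  have hwne : ∀ k, w (k + 2) ≠ w k := fun k => by rw [hwo]; exact hne _ _ _
  have hwn : ∀ k x, R (w (k + 1)) x → x = w k ∨ x = w (k + 2) := fun k x hx => by
    rw [hwo]; exact ho _ _ _ x hx
  have hwn' : ∀ k x, R (w k) x → x = w (k - 1) ∨ x = w (k + 1) := fun k x hx => by
    have := hwn (k - 1) x
    rw [sub_add_cancel, show k - 1 + 2 = k + 1 by ring] at this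
    exact this hx
  have hsurj : ∀ x, ∃ k, w k = x :=
    hG.forall_of_closed hsymm (fun g hg a b => (hR g hg a b).1) (a := a₀) (b := b₀)
      (fun h => hirr a₀ (by rw [← h] at h₀; exact h₀)) h₀ (P := fun x => ∃ k, w k = x) (by
        rintro _ y hy ⟨k, rfl⟩
        rcases hwn' k y hy with h | h
        · exact ⟨_, h.symm⟩
        · exact ⟨_, h.symm⟩) (x := w 0) ⟨0, rfl⟩
  -- a non-backtracking walk is determined by two consecutive vertices
  have huniq : ∀ x y : ℤ → Ω, (∀ k, R (x (k + 1)) (x k)) → (∀ k, R (y (k + 1)) (y k)) →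
      (∀ k, x (k + 2) ≠ x k) → (∀ k, y (k + 2) ≠ y k) → x 0 = y 0 → x 1 = y 1 →
      ∀ k, x k = y k ∧ x (k + 1) = y (k + 1) := by
    intro x y hx hy hxn hyn e0 e1 k
    induction k using Int.induction_on with
    | zero => exact ⟨e0, by simpa using e1⟩
    | succ k ih =>
      refine ⟨ih.2, ?_⟩
      have h₁ := hx (k + 1)
      have h₂ := hy (k + 1)
      have h₃ := hxn k
      have h₄ := hyn k
      rw [show (k : ℤ) + 2 = k + 1 + 1 by ring] at h₃ h₄
      rw [← ih.2] at h₂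
      rw [← ih.1] at h₄
      exact hou _ _ _ _ (hx k) (hsymm _ _ h₁) (hsymm _ _ h₂) h₃ h₄
    | pred k ih =>
      rw [show (-(k : ℤ) - 1 + 1) = -k by ring]
      refine ⟨?_, ih.1⟩
      have h₁ := hx (-k - 1)
      have h₂ := hy (-k - 1)
      have h₃ := hxn (-k - 1)
      have h₄ := hyn (-k - 1)
      rw [show (-(k : ℤ) - 1 + 1) = -k by ring] at h₁ h₂
      rw [show (-(k : ℤ) - 1 + 2) = -k + 1 by ring] at h₃ h₄
      rw [← ih.1] at h₂
      rw [← ih.2] at h₄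
      exact hou _ _ _ _ (hsymm _ _ (hx (-k))) h₁ h₂ h₃.symm h₄.symm
  have hfwd : ∀ c k, R (w (c + (k + 1))) (w (c + k)) := fun c k => by
    rw [← add_assoc]; exact hwR _
  have hfwdne : ∀ c k, w (c + (k + 2)) ≠ w (c + k) := fun c k => by
    rw [← add_assoc]; exact hwne _
  have hbwd : ∀ c k, R (w (c - (k + 1))) (w (c - k)) := fun c k => by
    have := hsymm _ _ (hwR (c - (k + 1)))
    rwa [show c - (k + 1) + 1 = c - k by ring] at this
  have hbwdne : ∀ c k, w (c - (k + 2)) ≠ w (c - k) := fun c k => by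
    have := hwne (c - (k + 2))
    rw [show c - (k + 2) + 2 = c - k by ring] at this
    exact this.symm
  have hperiod : ∀ i j, w i = w j → w (i + 1) = w (j + 1) := by
    intro i j hij
    rcases hwn' j (w (i + 1)) (hij ▸ hsymm _ _ (hwR i)) with h | h
    · exfalso
      have key := huniq (fun k => w (i + k)) (fun k => w (j - k)) (hfwd i) (hbwd j) (hfwdne i)
        (hbwdne j) (by simpa using hij) h
      rcases Int.even_or_odd' (j - i) with ⟨m, hm | hm⟩
      · have := (key (m - 1)).1
        rw [show j - (m - 1) = i + (m - 1) + 2 by linarith] at this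
        exact hwne _ this.symm
      · have := (key m).1
        rw [show j - m = i + m + 1 by linarith] at this
        have h2 := hwR (i + m)
        rw [← this] at h2
        exact hirr _ h2
    · exact h
  choose s hs using hsurj
  let ρ₀ : Ω → Ω := fun x => w (s x + 1)
  have hρw : ∀ k, ρ₀ (w k) = w (k + 1) := fun k => hperiod _ _ (hs _)
  have hρs : Function.Surjective ρ₀ := fun x => ⟨w (s x - 1), by rw [hρw, sub_add_cancel, hs]⟩
  let ρ : Equiv.Perm Ω := Equiv.ofBijective ρ₀ (Finite.surjective_iff_bijective.1 hρs)
  have hρw : ∀ k, ρ (w k) = w (k + 1) := hρw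
  have hρw' : ∀ k, ρ⁻¹ (w k) = w (k - 1) := fun k => by
    rw [Equiv.Perm.inv_eq_iff_eq, hρw, sub_add_cancel]
  refine ⟨ρ, fun h => ?_, fun g hg => ?_⟩
  · have h1 := hρw 0
    have h2 := hwR 0
    rw [h, Equiv.Perm.one_apply] at h1
    rw [← h1] at h2
    exact hirr _ h2
  · have hgR : ∀ k, R (g (w (k + 1))) (g (w k)) := fun k => (hR g hg _ _).1 (hwR k)
    have hgne : ∀ k, g (w (k + 2)) ≠ g (w k) := fun k h => hwne k (g.injective h)
    set c := s (g (w 0)) with hc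
    have hc0 : g (w 0) = w c := (hs _).symm
    rcases hwn' c (g (w 1)) (by rw [← hc0]; exact hsymm _ _ (hgR 0)) with h | h
    · right
      have key := huniq (fun k => g (w k)) (fun k => w (c - k)) hgR (hbwd c) hgne (hbwdne c)
        (by simpa using hc0) h
      have key : ∀ k, g (w k) = w (c - k) := fun k => (key k).1
      refine Equiv.ext fun x => ?_
      rw [← hs x, Equiv.Perm.mul_apply, Equiv.Perm.mul_apply, hρw, key, key, hρw']
      congr 1
      ring
    · left
      have key := huniq (fun k => g (w k)) (fun k => w (c + k)) hgR (hfwd c) hgne (hfwdne c)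
        (by simpa using hc0) h
      have key : ∀ k, g (w k) = w (c + k) := fun k => (key k).1
      refine Equiv.ext fun x => ?_
      rw [← hs x, Equiv.Perm.mul_apply, Equiv.Perm.mul_apply, hρw, key, key, hρw]
      congr 1
      ring

end Rotation

section Labels

variable {Ω : Type*} {Γ : Set (Ω × Ω)} {d : ℕ}

/-- The adjacency matrix of a digraph, whose rows are indicators of neighbourhoods. -/
noncomputable def digraphMatrix (Γ : Set (Ω × Ω)) : Matrix Ω Ω ℚ :=
  Matrix.of fun u v => (nbhd Γ u).indicator 1 v

open scoped Classical in
theorem digraphMatrix_apply (u v : Ω) :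
    digraphMatrix Γ u v = if (u, v) ∈ Γ then 1 else 0 :=
  Set.indicator_apply _ _ _

theorem digraphMatrix_apply_apply {g : Equiv.Perm Ω} (hg : g ∈ digraphAut Γ) (u v : Ω) :
    digraphMatrix Γ (g u) (g v) = digraphMatrix Γ u v := by
  rw [digraphMatrix_apply, digraphMatrix_apply, ← hg u v]

variable [DecidableEq Ω]

theorem single_sub_single_inj {a b a' b' : Ω} (hab : a ≠ b)
    (h : (Pi.single a 1 - Pi.single b 1 : Ω → ℚ) = Pi.single a' 1 - Pi.single b' 1) :
    a = a' ∧ b = b' := by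
  constructor
  · by_contra hne
    have := congrFun h a
    simp only [Pi.sub_apply, Pi.single_apply, hab, hne, if_true, if_false] at this
    split_ifs at this <;> norm_num at this
  · by_contra hne
    have := congrFun h b
    simp only [Pi.sub_apply, Pi.single_apply, hab.symm, hne, if_true, if_false] at this
    split_ifs at this <;> norm_num at this

/-- The neighbourhoods of `u` and `t` differ by exchanging `a` for `b`. -/
def IsLabel (Γ : Set (Ω × Ω)) (u t a b : Ω) : Prop :=
  a ≠ b ∧ (digraphMatrix Γ).row u - (digraphMatrix Γ).row t = Pi.single a 1 - Pi.single b 1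

theorem IsLabel.swap {u t a b : Ω} (h : IsLabel Γ u t a b) : IsLabel Γ t u b a :=
  ⟨h.1.symm, by rw [← neg_sub, h.2, neg_sub]⟩

theorem IsLabel.unique {u t a b a' b' : Ω} (h : IsLabel Γ u t a b) (h' : IsLabel Γ u t a' b') :
    a = a' ∧ b = b' :=
  single_sub_single_inj h.1 (h.2.symm.trans h'.2)

theorem IsLabel.map {g : Equiv.Perm Ω} (hg : g ∈ digraphAut Γ) {u t a b : Ω}
    (h : IsLabel Γ u t a b) : IsLabel Γ (g u) (g t) (g a) (g b) := by
  refine ⟨fun e => h.1 (g.injective e), funext fun y => ?_⟩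
  obtain ⟨y, rfl⟩ := g.surjective y
  have := congrFun h.2 y
  simp only [Pi.sub_apply, Matrix.row_apply, Pi.single_apply, digraphMatrix_apply_apply hg,
    EmbeddingLike.apply_eq_iff_eq] at this ⊢
  exact this

theorem exists_isLabel [Finite Ω] (hreg : ∀ v : Ω, (nbhd Γ v).ncard = d) {u t : Ω}
    (h : (u, t) ∈ GammaI Γ d 1) : ∃ a b, IsLabel Γ u t a b := by
  obtain ⟨a, ha⟩ := exists_nbhd_diff_eq_singleton hreg h
  obtain ⟨b, hb⟩ := exists_nbhd_diff_eq_singleton hreg (gammaI_symm h)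
  have ha' : ∀ x, _ ↔ _ := Set.ext_iff.1 ha
  have hb' : ∀ x, _ ↔ _ := Set.ext_iff.1 hb
  simp only [Set.mem_sdiff, Set.mem_singleton_iff] at ha' hb'
  have hab : a ≠ b := by
    rintro rfl
    exact ((hb' a).2 rfl).2 ((ha' a).2 rfl).1
  refine ⟨a, b, hab, funext fun y => ?_⟩
  have h₁ := ha' y
  have h₂ := hb' y
  simp only [nbhd, Set.mem_ofPred_eq] at h₁ h₂
  simp only [Pi.sub_apply, Matrix.row_apply, Pi.single_apply, digraphMatrix_apply]
  by_cases h₃ : (u, y) ∈ Γ <;> by_cases h₄ : (t, y) ∈ Γ <;> simp [← h₁, ← h₂, h₃, h₄]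

/-- The arcs `(a, b)` occurring as labels of arcs of `Γ_1`. -/
def labelRel (Γ : Set (Ω × Ω)) (d : ℕ) (a b : Ω) : Prop :=
  ∃ u t, (u, t) ∈ GammaI Γ d 1 ∧ IsLabel Γ u t a b

theorem labelRel.symm {a b : Ω} (h : labelRel Γ d a b) : labelRel Γ d b a := by
  obtain ⟨u, t, h, hl⟩ := h
  exact ⟨t, u, gammaI_symm h, hl.swap⟩

theorem labelRel.ne {a b : Ω} (h : labelRel Γ d a b) : a ≠ b := by
  obtain ⟨u, t, h, hl⟩ := h
  exact hl.1

theorem labelRel.map {g : Equiv.Perm Ω} (hg : g ∈ digraphAut Γ) {a b : Ω}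
    (h : labelRel Γ d a b) : labelRel Γ d (g a) (g b) := by
  obtain ⟨u, t, h, hl⟩ := h
  exact ⟨g u, g t, (gammaI_iff_of_mem_digraphAut hg u t).1 h, hl.map hg⟩

theorem labelRel_iff_of_mem_digraphAut {g : Equiv.Perm Ω} (hg : g ∈ digraphAut Γ) (a b : Ω) :
    labelRel Γ d a b ↔ labelRel Γ d (g a) (g b) :=
  ⟨fun h => h.map hg, fun h => by simpa using h.map (inv_mem hg)⟩

/-- The adjacency matrix of a vertex-primitive digraph with `Γ_1` nonempty is invertible. -/
theorem exists_digraphMatrix_mul_eq_one [Fintype Ω] (hprim : VertexPrimitive Γ)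
    (hreg : ∀ v : Ω, (nbhd Γ v).ncard = d) {u₀ v₀ : Ω} (h₀ : (u₀, v₀) ∈ GammaI Γ d 1) :
    ∃ B : Matrix Ω Ω ℚ, digraphMatrix Γ * B = 1 := by
  obtain ⟨a₀, b₀, hl⟩ := exists_isLabel hreg h₀
  set V : Submodule ℚ (Ω → ℚ) := LinearMap.range (Matrix.vecMulLinear (digraphMatrix Γ)) with hV
  have hrow : ∀ u, (digraphMatrix Γ).row u ∈ V := fun u =>
    ⟨Pi.single u 1, by
      rw [Matrix.vecMulLinear_apply, Matrix.single_one_vecMul]⟩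
  have hdiff : ∀ a b, (Pi.single b 1 - Pi.single a 1 : Ω → ℚ) ∈ V := by
    intro a
    refine hprim.forall_of_closed (R := labelRel Γ d) (fun _ _ h => h.symm)
      (fun g hg x y h => h.map hg) hl.1 ⟨u₀, v₀, h₀, hl⟩ (x := a) ?_ (by simp)
    rintro x y ⟨u, t, -, hlxy⟩ hx
    have := V.sub_mem hx (hlxy.2 ▸ V.sub_mem (hrow u) (hrow t))
    simpa using this
  have hd : (d : ℚ) ≠ 0 := by
    have : (nbhd Γ u₀ ∩ nbhd Γ v₀).ncard + 1 = d := h₀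
    have : d ≠ 0 := by omega
    exact_mod_cast this
  have hsum : ∑ y, digraphMatrix Γ u₀ y = d := by
    classical
    have hN : nbhd Γ u₀ = (Finset.univ.filter fun v => (u₀, v) ∈ Γ : Finset Ω) := by
      ext v
      simp [nbhd]
    rw [← hreg u₀, hN, Set.ncard_coe_finset]
    simp [digraphMatrix_apply]
  have hsingle : ∀ a, (Pi.single a 1 : Ω → ℚ) ∈ V := by
    intro a
    have h₁ : ∑ y, digraphMatrix Γ u₀ y • (Pi.single y 1 - Pi.single a 1 : Ω → ℚ) ∈ V :=
      V.sum_mem fun y _ => V.smul_mem _ (hdiff a y)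
    have h₂ : ∑ y, digraphMatrix Γ u₀ y • (Pi.single y 1 - Pi.single a 1 : Ω → ℚ) =
        (digraphMatrix Γ).row u₀ - (d : ℚ) • Pi.single a 1 := by
      simp only [smul_sub, Finset.sum_sub_distrib, ← Finset.sum_smul, hsum]
      congr 1
      exact (pi_eq_sum_univ' _).symm
    rw [h₂] at h₁
    have h₃ := V.sub_mem (hrow u₀) h₁
    rw [sub_sub_cancel] at h₃
    exact (V.smul_mem_iff hd).1 h₃
  have hsurj : Function.Surjective (digraphMatrix Γ).vecMul := by
    intro f
    have : f ∈ V := by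
      rw [pi_eq_sum_univ' f]
      exact V.sum_mem fun y _ => V.smul_mem _ (hsingle y)
    exact this
  obtain ⟨B, hB⟩ := Matrix.vecMul_surjective_iff_exists_left_inverse.1 hsurj
  exact ⟨B, mul_eq_one_comm.1 hB⟩

theorem IsLabel.single_sub_single_eq [Fintype Ω] {B : Matrix Ω Ω ℚ} (hB : digraphMatrix Γ * B = 1)
    {u t a b : Ω} (h : IsLabel Γ u t a b) :
    (Pi.single u 1 - Pi.single t 1 : Ω → ℚ) = B.row a - B.row b := by
  have h₁ := congrArg (fun f => Matrix.vecMul f B) h.2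
  simp only [Matrix.sub_vecMul, Matrix.single_one_vecMul] at h₁
  have h₂ : ∀ v, Matrix.vecMul ((digraphMatrix Γ).row v) B = Pi.single v 1 := by
    intro v
    rw [← Matrix.single_one_vecMul, Matrix.vecMul_vecMul, hB, Matrix.vecMul_one]
  rw [h₂, h₂] at h₁
  exact h₁

end Labels

section Star

variable {Ω : Type*} [Fintype Ω]

theorem exists_perm_of_equivariant {G : Subgroup (Equiv.Perm Ω)} (hG : IsPrimitiveSubgroup G)
    [Nonempty Ω] {π : Ω → Ω} (hπ : ∀ g ∈ G, ∀ u, π (g u) = g (π u)) :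
    ∃ ρ : Equiv.Perm Ω, (∀ u, ρ u = π u) ∧ ∀ g ∈ G, SemiconjBy g ρ ρ := by
  have hsurj : Function.Surjective π := by
    intro y
    obtain ⟨x⟩ := ‹Nonempty Ω›
    obtain ⟨g, hg, rfl⟩ := hG.exists_apply_eq (π x) y
    exact ⟨g x, hπ g hg x⟩
  refine ⟨Equiv.ofBijective π (Finite.surjective_iff_bijective.1 hsurj), fun _ => rfl, ?_⟩
  intro g hg
  ext u
  exact (hπ g hg u).symm

variable [DecidableEq Ω]

theorem IsPrimitiveSubgroup.card_edgeCut_singleton_eq {G : Subgroup (Equiv.Perm Ω)}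
    (hG : IsPrimitiveSubgroup G) {H : Ω → Ω → Prop} [DecidableRel H]
    (hGH : ∀ g ∈ G, ∀ a b, H a b ↔ H (g a) (g b)) (a b : Ω) :
    (edgeCut H {a}).card = (edgeCut H {b}).card := by
  obtain ⟨g, hg, rfl⟩ := hG.exists_apply_eq a b
  simpa using (card_edgeCut_map (hGH g hg) {a}).symm

variable {Γ : Set (Ω × Ω)} {d : ℕ}

theorem IsLabel.ends_unique {B : Matrix Ω Ω ℚ} (hB : digraphMatrix Γ * B = 1)
    {u t u' t' a b : Ω} (hut : u ≠ t) (h : IsLabel Γ u t a b) (h' : IsLabel Γ u' t' a b) :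
    u = u' ∧ t = t' :=
  single_sub_single_inj hut
    ((h.single_sub_single_eq hB).trans (h'.single_sub_single_eq hB).symm)

open scoped Classical in
/-- The valency of `Γ_1` is at most that of the relation formed by its labels. -/
theorem valency_le_labelRel_valency (hprim : VertexPrimitive Γ)
    (hreg : ∀ v : Ω, (nbhd Γ v).ncard = d) {m k : ℕ} {u₀ v₀ : Ω}
    (h₀ : (u₀, v₀) ∈ GammaI Γ d 1)
    (hm : ∀ u, (Finset.univ.filter fun t => (u, t) ∈ GammaI Γ d 1).card = m)
    (hk : ∀ a, (Finset.univ.filter (labelRel Γ d a)).card = k) : m ≤ k := by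
  obtain ⟨B, hB⟩ := exists_digraphMatrix_mul_eq_one hprim hreg h₀
  have hf : ∀ e : Ω × Ω, ∃ p : Ω × Ω, e ∈ GammaI Γ d 1 → IsLabel Γ e.1 e.2 p.1 p.2 := by
    intro e
    by_cases h : e ∈ GammaI Γ d 1
    · obtain ⟨a, b, hl⟩ := exists_isLabel hreg (u := e.1) (t := e.2) h
      exact ⟨(a, b), fun _ => hl⟩
    · exact ⟨e, fun h' => absurd h' h⟩
  choose f hf using hf
  have h₁ : (Finset.univ.sigma fun u => Finset.univ.filter fun t => (u, t) ∈ GammaI Γ d 1).card ≤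
      (Finset.univ.sigma fun a => Finset.univ.filter (labelRel Γ d a)).card := by
    refine Finset.card_le_card_of_injOn
      (fun e => ⟨(f (e.1, e.2)).1, (f (e.1, e.2)).2⟩) ?_ ?_
    · rintro ⟨u, t⟩ h
      have h : (u, t) ∈ GammaI Γ d 1 := by simpa using h
      have h' : labelRel Γ d (f (u, t)).1 (f (u, t)).2 := ⟨u, t, h, hf _ h⟩
      simpa using h'
    · rintro ⟨u, t⟩ h ⟨u', t'⟩ h' e
      have h : (u, t) ∈ GammaI Γ d 1 := by simpa using h
      have h' : (u', t') ∈ GammaI Γ d 1 := by simpa using h'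
      have e : f (u, t) = f (u', t') := by
        simpa [Prod.ext_iff] using e
      obtain ⟨rfl, rfl⟩ := IsLabel.ends_unique hB (ne_of_mem_gammaI_one hreg h) (hf _ h)
        (e ▸ hf _ h')
      rfl
  rw [Finset.card_sigma, Finset.card_sigma] at h₁
  simp only [hm, hk, Finset.sum_const, smul_eq_mul] at h₁
  exact Nat.le_of_mul_le_mul_left h₁ (Finset.card_pos.2 ⟨u₀, Finset.mem_univ _⟩)

open scoped Classical in
/-- If `Γ_1` has valency at least `3`, then the labels of the arcs at a vertex form a star. -/
theorem exists_forall_isLabel_eq (hprim : VertexPrimitive Γ)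
    (hreg : ∀ v : Ω, (nbhd Γ v).ncard = d) {m : ℕ} (hm3 : 3 ≤ m)
    (hm : ∀ u, (Finset.univ.filter fun t => (u, t) ∈ GammaI Γ d 1).card = m) (u : Ω) :
    (∃ x, ∀ t a b, (u, t) ∈ GammaI Γ d 1 → IsLabel Γ u t a b → a = x) ∨
      ∃ y, ∀ t a b, (u, t) ∈ GammaI Γ d 1 → IsLabel Γ u t a b → b = y := by
  obtain ⟨t₀, ht₀⟩ : (Finset.univ.filter fun t => (u, t) ∈ GammaI Γ d 1).Nonempty := by
    rw [← Finset.card_pos, hm]; omega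
  have ht₀ : (u, t₀) ∈ GammaI Γ d 1 := by simpa using ht₀
  obtain ⟨B, hB⟩ := exists_digraphMatrix_mul_eq_one hprim hreg ht₀
  have hGH := fun g (hg : g ∈ digraphAut Γ) => labelRel_iff_of_mem_digraphAut (d := d) hg
  have hHs : ∀ a b, labelRel Γ d a b → labelRel Γ d b a := fun _ _ h => h.symm
  have hHi : ∀ a, ¬ labelRel Γ d a a := fun a h => h.ne rfl
  set k := (edgeCut (labelRel Γ d) {u}).card with hkdef
  have hk : ∀ a, (edgeCut (labelRel Γ d) {a}).card = k := fun a =>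
    hprim.card_edgeCut_singleton_eq hGH a u
  have hmk : m ≤ k := valency_le_labelRel_valency hprim hreg ht₀ hm fun a => by
    rw [← card_edgeCut_singleton hHi, hk]
  have hl : ∀ t, ∃ p : Ω × Ω, (u, t) ∈ GammaI Γ d 1 → IsLabel Γ u t p.1 p.2 := by
    intro t
    by_cases h : (u, t) ∈ GammaI Γ d 1
    · obtain ⟨a, b, hl⟩ := exists_isLabel hreg h
      exact ⟨(a, b), fun _ => hl⟩
    · exact ⟨(t, t), fun h' => absurd h' h⟩
  choose f hf using hl
  obtain ⟨z, -, hz⟩ := Finset.exists_max_image Finset.univ (fun a => B a u) ⟨u, Finset.mem_univ _⟩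
  have hz : ∀ a, B a u ≤ B z u := fun a => hz a (Finset.mem_univ _)
  set X : Finset Ω := Finset.univ.filter fun a => B a u = B z u with hX
  have hsub : edgeCut (labelRel Γ d) X ⊆
      (Finset.univ.filter fun t => (u, t) ∈ GammaI Γ d 1).image f := by
    rintro ⟨a, b⟩ h
    simp only [edgeCut, hX, Finset.mem_filter, Finset.mem_univ, true_and] at h
    obtain ⟨⟨s, t, hst, hlab⟩, ha, hb⟩ := h
    have hlt : B b u < B a u := ha ▸ lt_of_le_of_ne (hz b) hb
    have hdiff := congrFun (hlab.single_sub_single_eq hB) u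
    simp only [Pi.sub_apply, Matrix.row_apply, Pi.single_apply] at hdiff
    have hs : u = s := by
      by_contra hne
      rw [if_neg hne] at hdiff
      split_ifs at hdiff <;> linarith
    subst hs
    rw [Finset.mem_image]
    refine ⟨t, by simpa using hst, ?_⟩
    obtain ⟨h₁, h₂⟩ := (hf t hst).unique hlab
    exact Prod.ext h₁ h₂
  have hcard : ((Finset.univ.filter fun t => (u, t) ∈ GammaI Γ d 1).image f).card ≤ m :=
    Finset.card_image_le.trans (hm u).le
  have hXk : (edgeCut (labelRel Γ d) X).card ≤ k :=
    ((Finset.card_le_card hsub).trans hcard).trans hmk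
  have hXc : Xᶜ.Nonempty := by
    refine ⟨(f t₀).2, ?_⟩
    have hdiff := congrFun ((hf t₀ ht₀).single_sub_single_eq hB) u
    simp only [Pi.sub_apply, Matrix.row_apply, Pi.single_apply, if_true,
      if_neg (ne_of_mem_gammaI_one hreg ht₀)] at hdiff
    have := hz (f t₀).1
    simp only [hX, Finset.mem_compl, Finset.mem_filter, Finset.mem_univ, true_and]
    intro e
    linarith
  have hXn : X.Nonempty := ⟨z, by simp [hX]⟩
  have hstar := hprim.card_eq_one_of_card_edgeCut_le hHs hGH hk (hm3.trans hmk) hXn hXc hXk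
  have hXeq : (edgeCut (labelRel Γ d) X).card = k := by
    rcases hstar with h | h
    · obtain ⟨x, hx⟩ := Finset.card_eq_one.1 h
      rw [hx, hk]
    · obtain ⟨x, hx⟩ := Finset.card_eq_one.1 h
      rw [← card_edgeCut_compl hHs, hx, hk]
  have heq := Finset.eq_of_subset_of_card_le hsub (by omega)
  have hmem : ∀ t a b, (u, t) ∈ GammaI Γ d 1 → IsLabel Γ u t a b → a ∈ X ∧ b ∉ X := by
    intro t a b ht hab
    have hft : f t ∈ edgeCut (labelRel Γ d) X := by
      rw [heq]
      exact Finset.mem_image_of_mem _ (by simpa using ht)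
    obtain ⟨rfl, rfl⟩ := (hf t ht).unique hab
    simp only [edgeCut, Finset.mem_filter, Finset.mem_univ, true_and] at hft
    exact hft.2
  rcases hstar with h | h
  · obtain ⟨x, hx⟩ := Finset.card_eq_one.1 h
    exact .inl ⟨x, fun t a b ht hab => by simpa [hx] using (hmem t a b ht hab).1⟩
  · obtain ⟨x, hx⟩ := Finset.card_eq_one.1 h
    refine .inr ⟨x, fun t a b ht hab => ?_⟩
    have := Finset.mem_compl.2 (hmem t a b ht hab).2
    simpa [hx] using this

theorem exists_perm_of_row_sub_row_eq (hprim : VertexPrimitive Γ)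
    (hreg : ∀ v : Ω, (nbhd Γ v).ncard = d) {u₀ v₀ : Ω} (h₀ : (u₀, v₀) ∈ GammaI Γ d 1)
    {π : Ω → Ω} (hπ : ∀ g ∈ digraphAut Γ, ∀ u, π (g u) = g (π u)) {ε : ℚ} (hε : ε = 1 ∨ ε = -1)
    (h : ∀ u t, (u, t) ∈ GammaI Γ d 1 → (digraphMatrix Γ).row u - (digraphMatrix Γ).row t =
      ε • (Pi.single (π u) 1 - Pi.single (π t) 1 : Ω → ℚ)) :
    ∃ ρ : Equiv.Perm Ω, (∀ g ∈ digraphAut Γ, SemiconjBy g ρ ρ) ∧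
      ((∀ u v, (u, v) ∈ Γ ↔ v = ρ u) ∨ ∀ u v, (u, v) ∈ Γ ↔ v ≠ ρ u) := by
  have : Nonempty Ω := ⟨u₀⟩
  have hne := ne_of_mem_gammaI_one hreg h₀
  set F : Ω → Ω → ℚ := fun u => (digraphMatrix Γ).row u - ε • Pi.single (π u) 1 with hF
  have hFadj : ∀ u t, (u, t) ∈ GammaI Γ d 1 → F t = F u := by
    intro u t hut
    have := h u t hut
    rw [smul_sub, sub_eq_sub_iff_sub_eq_sub] at this
    exact this.symm
  have hF₀ : ∀ u, F u = F u₀ := hprim.forall_of_closed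
    (R := fun u t => (u, t) ∈ GammaI Γ d 1) (fun _ _ h => gammaI_symm h)
    (fun g hg a b => (gammaI_iff_of_mem_digraphAut hg a b).1) hne h₀
    (fun x y hxy hx => (hFadj x y hxy).trans hx) rfl
  have hFinv : ∀ g ∈ digraphAut Γ, ∀ u v, F (g u) (g v) = F u v := by
    intro g hg u v
    simp [hF, Pi.single_apply, digraphMatrix_apply_apply hg, hπ g hg]
  have hFc : ∀ u v, F u v = F u₀ u₀ := by
    intro u v
    obtain ⟨g, hg, rfl⟩ := hprim.exists_apply_eq u₀ v
    rw [hF₀]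
    exact (congrFun (hF₀ (g u₀)) _).symm.trans (hFinv g hg _ _)
  set c := F u₀ u₀
  have hM : ∀ u v, digraphMatrix Γ u v = c + if v = π u then ε else 0 := by
    intro u v
    rw [← hFc u v]
    simp [hF, Pi.single_apply]
  have h01 : ∀ u v, digraphMatrix Γ u v = 0 ∨ digraphMatrix Γ u v = 1 := by
    intro u v
    rw [digraphMatrix_apply]
    split_ifs <;> simp
  have hΓ : ∀ u v, (u, v) ∈ Γ ↔ digraphMatrix Γ u v = 1 := by
    intro u v
    rw [digraphMatrix_apply]
    split_ifs with h <;> simp [h]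
  obtain ⟨ρ, hρ, hρG⟩ := exists_perm_of_equivariant hprim hπ
  refine ⟨ρ, hρG, ?_⟩
  have : Nontrivial Ω := ⟨u₀, v₀, hne⟩
  obtain ⟨w, hw⟩ := exists_ne (π u₀)
  have h₁ := h01 u₀ w
  have h₂ := h01 u₀ (π u₀)
  rw [hM, if_neg hw] at h₁
  rw [hM, if_pos rfl] at h₂
  rcases hε with rfl | rfl
  · have hc : c = 0 := by
      rcases h₁ with h₁ | h₁ <;> rcases h₂ with h₂ | h₂ <;> linarith
    left
    intro u v
    rw [hΓ, hM, hc, hρ]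
    split_ifs with hv <;> simp [hv]
  · have hc : c = 1 := by
      rcases h₁ with h₁ | h₁ <;> rcases h₂ with h₂ | h₂ <;> linarith
    right
    intro u v
    rw [hΓ, hM, hc, hρ]
    split_ifs with hv <;> simp [hv]

/-- If the labels of the arcs at a vertex form a star, then `Γ` is, up to complement, the graph of
a permutation centralised by `Aut(Γ)`. -/
theorem exists_perm_of_forall_isLabel (hprim : VertexPrimitive Γ)
    (hreg : ∀ v : Ω, (nbhd Γ v).ncard = d) {u₀ v₀ : Ω} (h₀ : (u₀, v₀) ∈ GammaI Γ d 1)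
    (h : (∃ x, ∀ t a b, (u₀, t) ∈ GammaI Γ d 1 → IsLabel Γ u₀ t a b → a = x) ∨
      ∃ y, ∀ t a b, (u₀, t) ∈ GammaI Γ d 1 → IsLabel Γ u₀ t a b → b = y) :
    ∃ ρ : Equiv.Perm Ω, (∀ g ∈ digraphAut Γ, SemiconjBy g ρ ρ) ∧
      ((∀ u v, (u, v) ∈ Γ ↔ v = ρ u) ∨ ∀ u v, (u, v) ∈ Γ ↔ v ≠ ρ u) := by
  have hex : ∀ u, ∃ t a b, (u, t) ∈ GammaI Γ d 1 ∧ IsLabel Γ u t a b := by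
    intro u
    obtain ⟨g, hg, rfl⟩ := hprim.exists_apply_eq u₀ u
    have h₁ := (gammaI_iff_of_mem_digraphAut hg _ _).1 h₀
    obtain ⟨a, b, hl⟩ := exists_isLabel hreg h₁
    exact ⟨g v₀, a, b, h₁, hl⟩
  rcases h with ⟨x, hx⟩ | ⟨y, hy⟩
  · have hall : ∀ u, ∃ x, ∀ t a b, (u, t) ∈ GammaI Γ d 1 → IsLabel Γ u t a b → a = x := by
      intro u
      obtain ⟨g, hg, rfl⟩ := hprim.exists_apply_eq u u₀
      refine ⟨g⁻¹ x, fun t a b ht hl => ?_⟩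
      rw [← hx _ _ _ ((gammaI_iff_of_mem_digraphAut hg _ _).1 ht) (hl.map hg)]
      simp
    choose π hπ using hall
    refine exists_perm_of_row_sub_row_eq hprim hreg h₀ (π := π) ?_ (.inl rfl) ?_
    · intro g hg u
      obtain ⟨t, a, b, ht, hl⟩ := hex u
      rw [← hπ _ _ _ _ ht hl,
        ← hπ _ _ _ _ ((gammaI_iff_of_mem_digraphAut hg _ _).1 ht) (hl.map hg)]
    · intro u t ht
      obtain ⟨a, b, hl⟩ := exists_isLabel hreg ht
      rw [hl.2, ← hπ _ _ _ _ ht hl, ← hπ _ _ _ _ (gammaI_symm ht) hl.swap, one_smul]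
  · have hall : ∀ u, ∃ y, ∀ t a b, (u, t) ∈ GammaI Γ d 1 → IsLabel Γ u t a b → b = y := by
      intro u
      obtain ⟨g, hg, rfl⟩ := hprim.exists_apply_eq u u₀
      refine ⟨g⁻¹ y, fun t a b ht hl => ?_⟩
      rw [← hy _ _ _ ((gammaI_iff_of_mem_digraphAut hg _ _).1 ht) (hl.map hg)]
      simp
    choose π hπ using hall
    refine exists_perm_of_row_sub_row_eq hprim hreg h₀ (π := π) ?_ (.inr rfl) ?_
    · intro g hg u
      obtain ⟨t, a, b, ht, hl⟩ := hex u
      rw [← hπ _ _ _ _ ht hl,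
        ← hπ _ _ _ _ ((gammaI_iff_of_mem_digraphAut hg _ _).1 ht) (hl.map hg)]
    · intro u t ht
      obtain ⟨a, b, hl⟩ := exists_isLabel hreg ht
      rw [hl.2, ← hπ _ _ _ _ ht hl, ← hπ _ _ _ _ (gammaI_symm ht) hl.swap, neg_smul, one_smul,
        neg_sub]

end Star

/-- **Corollary (κ = 1).** Let `Γ` be a vertex-primitive digraph of valency `d` with
`Γ_1 ≠ ∅`.  Then `Γ` is the diagonal, or the complete graph, or `|Ω| = p` is prime and
`Γ ≅ Δ_{p,x,d}` for some `x ∈ ℤ/pℤ` (and `d ≥ 1`). -/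
theorem stmt_5 {Ω : Type*} [Fintype Ω] (Γ : Set (Ω × Ω))
    (hprim : VertexPrimitive Γ) (d : ℕ)
    (hreg : ∀ v : Ω, (nbhd Γ v).ncard = d)
    (hΓ1 : GammaI Γ d 1 ≠ ∅) :
    Γ = Set.diagonal Ω ∨
    Γ = Set.univ \ Set.diagonal Ω ∨
    (∃ p : ℕ, p.Prime ∧ Fintype.card Ω = p ∧ 1 ≤ d ∧
      ∃ φ : Ω ≃ ZMod p, ∃ x : ZMod p, ∀ u v : Ω,
        ((u, v) ∈ Γ ↔ ∃ k : ℕ, 1 ≤ k ∧ k ≤ d ∧ φ v - φ u = x + (k : ZMod p))) := by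
  classical
  obtain ⟨⟨u₀, v₀⟩, h₀⟩ := Set.nonempty_iff_ne_empty.2 hΓ1
  have : Nonempty Ω := ⟨u₀⟩
  set J : Ω → Ω → Prop := fun u t => (u, t) ∈ GammaI Γ d 1 with hJ
  have hJG : ∀ g ∈ digraphAut Γ, ∀ a b, J a b ↔ J (g a) (g b) :=
    fun g hg => gammaI_iff_of_mem_digraphAut hg
  have hJs : ∀ a b, J a b → J b a := fun _ _ h => gammaI_symm h
  have hJi : ∀ a, ¬ J a a := fun a h => ne_of_mem_gammaI_one hreg h rfl
  have hm : ∀ u, (Finset.univ.filter (J u)).card = (Finset.univ.filter (J u₀)).card := fun u => by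
    rw [← card_edgeCut_singleton hJi, ← card_edgeCut_singleton hJi,
      IsPrimitiveSubgroup.card_edgeCut_singleton_eq hprim hJG u u₀]
  set m := (Finset.univ.filter (J u₀)).card with hmdef
  have hm0 : 0 < m := Finset.card_pos.2 ⟨v₀, by simpa using h₀⟩
  suffices key : Γ = Set.diagonal Ω ∨ Γ = Set.univ \ Set.diagonal Ω ∨ ∃ ρ : Equiv.Perm Ω, ρ ≠ 1 ∧
      ∀ g ∈ digraphAut Γ, SemiconjBy g ρ ρ ∨ SemiconjBy g ρ ρ⁻¹ by
    refine key.imp_right (Or.imp_right ?_)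
    rintro ⟨ρ, hρ, h⟩
    obtain ⟨n, φ, hφ⟩ := IsPrimitiveSubgroup.exists_equiv_zmod hprim hρ h
    exact exists_zmod_of_dihedral hprim hreg h₀ φ hφ
  obtain hm1 | hm2 | hm3 : m = 1 ∨ m = 2 ∨ 3 ≤ m := by omega
  · have hπ : ∀ u, ∃ w, ∀ t, J u t ↔ t = w := by
      intro u
      obtain ⟨w, hw⟩ := Finset.card_eq_one.1 ((hm u).trans hm1)
      exact ⟨w, fun t => by simpa using Finset.ext_iff.1 hw t⟩
    choose π hπ using hπ
    obtain ⟨ρ, hρ, hρG⟩ := exists_perm_of_equivariant hprim (π := π) fun g hg u =>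
      ((hπ _ _).1 ((hJG g hg _ _).1 ((hπ u _).2 rfl))).symm
    refine .inr (.inr ⟨ρ, ?_, fun g hg => .inl (hρG g hg)⟩)
    rintro rfl
    exact hJi u₀ ((hπ _ _).2 (hρ u₀))
  · refine .inr (.inr (IsPrimitiveSubgroup.exists_rotation hprim hJs hJi hJG h₀ ?_))
    intro u v huv
    obtain ⟨a, b, hab, h⟩ := Finset.card_eq_two.1 ((hm v).trans hm2)
    have h : ∀ x, J v x ↔ x = a ∨ x = b := fun x => by simpa using Finset.ext_iff.1 h x
    rcases (h u).1 huv with rfl | rfl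
    · exact ⟨b, (h b).2 (.inr rfl), hab.symm, fun x => (h x).1⟩
    · exact ⟨a, (h a).2 (.inl rfl), hab, fun x hx => ((h x).1 hx).symm⟩
  · obtain ⟨ρ, hρG, hΓ⟩ := exists_perm_of_forall_isLabel hprim hreg h₀
      (exists_forall_isLabel_eq hprim hreg hm3 hm u₀)
    by_cases hρ : ρ = 1
    · subst hρ
      rcases hΓ with hΓ | hΓ
      · left
        ext ⟨u, v⟩
        simpa [eq_comm] using hΓ u v
      · right; left
        ext ⟨u, v⟩
        simpa [eq_comm] using hΓ u v
    · exact .inr (.inr ⟨ρ, hρ, fun g hg => .inl (hρG g hg)⟩)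
end

section
/- Let Γ be a vertex-primitive digraph on a finite set Ω with ∅ ≠ Γ ≠ Ω × Ω, regular of valency d. Let κ be the smallest positive integer i with Γ_i ≠ ∅, and let ℓ = min{ i ≥ κ : Γ_{i+1} = ⋯ = Γ_{i+κ} = ∅ }. If ℓ ≥ κ + 1, then for every vertex α, ℓ(ℓ − 1) ≥ Σ_{i=1}^{ℓ−1} |Γ_i(α)| · (ℓ − i). -/
open scoped Pointwise

section Primitive

variable {Ω : Type*}

/-- An invariant equivalence relation of a primitive group which relates two distinct points
is universal. -/
theorem IsPrimitiveSubgroup.rel_of_rel_ne {G : Subgroup (Equiv.Perm Ω)}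
    (hG : IsPrimitiveSubgroup G) {r : Ω → Ω → Prop} (hr : Equivalence r)
    (hinv : ∀ g ∈ G, ∀ u v, r u v → r (g u) (g v)) {a b : Ω} (hab : a ≠ b) (h : r a b)
    (u v : Ω) : r u v := by
  have hblock : MulAction.IsBlock G {w | r a w} := by
    rw [MulAction.isBlock_iff_smul_eq_or_disjoint]
    intro g
    have hmem : ∀ x, x ∈ g • {w | r a w} ↔ r (g.1 a) x := by
      intro x
      rw [Set.mem_smul_set_iff_inv_smul_mem]
      constructor
      · intro hx
        have := hinv g.1 g.2 _ _ hx
        rwa [show g.1 (g⁻¹ • x) = x from smul_inv_smul g x] at this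
      · intro hx
        have := hinv _ (g⁻¹).2 _ _ hx
        rwa [show (g⁻¹).1 (g.1 a) = a from inv_smul_smul g a] at this
    by_cases hga : r a (g.1 a)
    · left
      ext x
      rw [hmem]
      exact ⟨fun hx => hr.trans hga hx, fun hx => hr.trans (hr.symm hga) hx⟩
    · right
      rw [Set.disjoint_left]
      intro x hx hx'
      rw [hmem] at hx
      exact hga (hr.trans hx' (hr.symm hx))
  rcases hG.2 _ hblock with hs | hs
  · exact absurd (hs (hr.refl a) h) hab
  · have hall : ∀ w, r a w := fun w => (Set.ext_iff.mp hs w).mpr trivial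
    exact hr.trans (hr.symm (hall u)) (hall v)

end Primitive

section Neighbourhoods

variable {Ω : Type*} {Γ : Set (Ω × Ω)}

@[simp]
theorem mem_nbhd {u v : Ω} : u ∈ nbhd Γ v ↔ (v, u) ∈ Γ := Iff.rfl

@[simp]
theorem mem_gammaI {d i : ℕ} {u v : Ω} :
    (u, v) ∈ GammaI Γ d i ↔ (nbhd Γ u ∩ nbhd Γ v).ncard + i = d := Iff.rfl

theorem nbhd_apply_of_mem_digraphAut {g : Equiv.Perm Ω} (hg : g ∈ digraphAut Γ) (v : Ω) :
    nbhd Γ (g v) = g '' nbhd Γ v := by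
  ext x
  rw [Equiv.image_eq_preimage_symm]
  have := hg v (g.symm x)
  rw [Equiv.apply_symm_apply] at this
  exact this.symm

theorem ncard_nbhd_inter_apply {g : Equiv.Perm Ω} (hg : g ∈ digraphAut Γ) (u v : Ω) :
    (nbhd Γ (g u) ∩ nbhd Γ (g v)).ncard = (nbhd Γ u ∩ nbhd Γ v).ncard := by
  rw [nbhd_apply_of_mem_digraphAut hg, nbhd_apply_of_mem_digraphAut hg,
    ← Set.image_inter g.injective, Set.ncard_image_of_injective _ g.injective]

theorem Set.ncard_inter_add_ncard_inter_le [Finite Ω] (A B C : Set Ω) :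
    (A ∩ B).ncard + (B ∩ C).ncard ≤ B.ncard + (A ∩ C).ncard := by
  rw [← Set.ncard_union_add_ncard_inter (A ∩ B) (B ∩ C)]
  refine add_le_add (Set.ncard_le_ncard ?_) (Set.ncard_le_ncard ?_)
  · rintro x (hx | hx)
    exacts [hx.2, hx.1]
  · exact fun x hx => ⟨hx.1.1, hx.2.2⟩

end Neighbourhoods

section Counting

variable {Ω : Type*} [Fintype Ω] {Γ : Set (Ω × Ω)} {d : ℕ}

open Classical in
/-- In a regular digraph with transitive automorphism group all in-degrees equal the valency. -/
theorem sum_indicator_mem_eq_valency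
    (htrans : MulAction.IsPretransitive (digraphAut Γ) Ω)
    (hreg : ∀ v : Ω, (nbhd Γ v).ncard = d) (w : Ω) :
    (∑ v : Ω, if (v, w) ∈ Γ then 1 else 0) = d := by
  have hconst : ∀ x : Ω, (∑ v : Ω, if (v, x) ∈ Γ then 1 else 0) =
      ∑ v : Ω, if (v, w) ∈ Γ then 1 else 0 := by
    intro x
    obtain ⟨g, rfl⟩ := htrans.exists_smul_eq w x
    refine (Fintype.sum_equiv g.1 _ _ fun v => ?_).symm
    exact if_congr (g.2 v w) rfl rfl
  have hout : ∀ v : Ω, (∑ x : Ω, if (v, x) ∈ Γ then 1 else 0) = d := by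
    intro v
    rw [← hreg v, Set.ncard_eq_toFinset_card', Finset.sum_boole, Nat.cast_id]
    congr 1
    ext x
    simp
  have hswap := Finset.sum_comm (s := (Finset.univ : Finset Ω)) (t := (Finset.univ : Finset Ω))
    (f := fun v x => if (v, x) ∈ Γ then 1 else 0)
  simp only [hout, hconst, Finset.sum_const, smul_eq_mul] at hswap
  exact (Nat.eq_of_mul_eq_mul_left (Finset.card_pos.mpr ⟨w, Finset.mem_univ w⟩) hswap).symm

theorem sum_ncard_nbhd_inter
    (htrans : MulAction.IsPretransitive (digraphAut Γ) Ω)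
    (hreg : ∀ v : Ω, (nbhd Γ v).ncard = d) (α : Ω) :
    ∑ β : Ω, (nbhd Γ α ∩ nbhd Γ β).ncard = d * d := by
  classical
  have hcard : ∀ β : Ω, (nbhd Γ α ∩ nbhd Γ β).ncard =
      ∑ x ∈ (nbhd Γ α).toFinset, if (β, x) ∈ Γ then 1 else 0 := by
    intro β
    rw [Set.ncard_eq_toFinset_card', Finset.sum_boole]
    congr 1
    ext x
    simp
  simp only [hcard]
  rw [Finset.sum_comm]
  simp only [sum_indicator_mem_eq_valency htrans hreg, Finset.sum_const, smul_eq_mul]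
  rw [← Set.ncard_eq_toFinset_card', hreg]

/-- If there are no repeated neighbourhoods and every two neighbourhoods meet in at least `d - ℓ`
points, the weighted sum of the sizes of the `Γ_i(α)` is at most `ℓ (n - 1) - d (n - d)`. -/
theorem sum_ncard_nbhd_gammaI_mul_le
    (htrans : MulAction.IsPretransitive (digraphAut Γ) Ω)
    (hreg : ∀ v : Ω, (nbhd Γ v).ncard = d) {ℓ : ℕ} (α : Ω)
    (hle : ∀ β : Ω, d ≤ (nbhd Γ α ∩ nbhd Γ β).ncard + ℓ) :
    ∑ i ∈ Finset.Icc 1 (ℓ - 1), (nbhd (GammaI Γ d i) α).ncard * (ℓ - i) +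
      Fintype.card Ω * d + ℓ ≤ Fintype.card Ω * ℓ + d * d := by
  classical
  have hcd : ∀ β : Ω, (nbhd Γ α ∩ nbhd Γ β).ncard ≤ d := fun β =>
    (Set.ncard_le_ncard Set.inter_subset_left).trans_eq (hreg α)
  have hcard : ∀ i, (nbhd (GammaI Γ d i) α).ncard * (ℓ - i) =
      ∑ β : Ω, if (nbhd Γ α ∩ nbhd Γ β).ncard + i = d then ℓ - i else 0 := by
    intro i
    rw [Set.ncard_eq_toFinset_card', ← Finset.sum_filter, Finset.sum_const, smul_eq_mul]
    congr 2
    ext x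
    simp
  have hterm : ∀ β : Ω, (∑ i ∈ Finset.Icc 1 (ℓ - 1),
      if (nbhd Γ α ∩ nbhd Γ β).ncard + i = d then ℓ - i else 0) + d + (if β = α then ℓ else 0) ≤
      ℓ + (nbhd Γ α ∩ nbhd Γ β).ncard := by
    intro β
    have hβ := hle β
    have hβ' := hcd β
    by_cases hαβ : β = α
    · subst hαβ
      rw [Finset.sum_eq_zero]
      · simp [hreg]; omega
      · intro i hi
        rw [Set.inter_self, hreg, if_neg]
        have := (Finset.mem_Icc.mp hi).1
        omega
    · have hsum : (∑ i ∈ Finset.Icc 1 (ℓ - 1),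
          if (nbhd Γ α ∩ nbhd Γ β).ncard + i = d then ℓ - i else 0) ≤
          ℓ - (d - (nbhd Γ α ∩ nbhd Γ β).ncard) := by
        calc _ ≤ ∑ i ∈ Finset.Icc 1 (ℓ - 1),
              if d - (nbhd Γ α ∩ nbhd Γ β).ncard = i then ℓ - i else 0 := by
              refine Finset.sum_le_sum fun i _ => ?_
              split_ifs <;> omega
          _ ≤ _ := by
              rw [Finset.sum_ite_eq]
              split_ifs <;> omega
      rw [if_neg hαβ]
      omega
  have hsum := Finset.sum_le_sum fun β (_ : β ∈ (Finset.univ : Finset Ω)) => hterm β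
  simp only [Finset.sum_add_distrib, sum_ncard_nbhd_inter htrans hreg, Finset.sum_const,
    Finset.sum_ite_eq', Finset.mem_univ, if_true, smul_eq_mul, Finset.card_univ] at hsum
  rw [Finset.sum_comm] at hsum
  simpa only [hcard] using hsum

end Counting

/-- If no pair of neighbourhoods has distance in `(ℓ, ℓ + κ]` and some pair has distance `κ > 0`,
then in a vertex-primitive digraph all distances are at most `ℓ`. -/
theorem VertexPrimitive.le_ncard_inter_add {Ω : Type*} [Finite Ω] {Γ : Set (Ω × Ω)}
    (hprim : VertexPrimitive Γ) {d : ℕ} (hreg : ∀ v : Ω, (nbhd Γ v).ncard = d)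
    {κ : ℕ} (hκpos : 0 < κ) (hκne : (GammaI Γ d κ).Nonempty) {ℓ : ℕ}
    (hℓgap : ∀ j : ℕ, ℓ + 1 ≤ j → j ≤ ℓ + κ → GammaI Γ d j = ∅) (u v : Ω) :
    d ≤ (nbhd Γ u ∩ nbhd Γ v).ncard + ℓ := by
  obtain ⟨⟨a, b⟩, hab⟩ := hκne
  have hab' : (nbhd Γ a ∩ nbhd Γ b).ncard + κ = d := hab
  have hne : a ≠ b := by
    rintro rfl
    rw [Set.inter_self, hreg] at hab'
    omega
  have hstep : ∀ x y w : Ω, (nbhd Γ x ∩ nbhd Γ y).ncard + κ = d →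
      d ≤ (nbhd Γ x ∩ nbhd Γ w).ncard + ℓ → d ≤ (nbhd Γ y ∩ nbhd Γ w).ncard + ℓ := by
    intro x y w hxy hxw
    by_contra! hyw
    have htri := Set.ncard_inter_add_ncard_inter_le (nbhd Γ y) (nbhd Γ x) (nbhd Γ w)
    rw [hreg, Set.inter_comm (nbhd Γ y)] at htri
    have hmem : (y, w) ∈ GammaI Γ d (d - (nbhd Γ y ∩ nbhd Γ w).ncard) := by
      change (nbhd Γ y ∩ nbhd Γ w).ncard + (d - (nbhd Γ y ∩ nbhd Γ w).ncard) = d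
      omega
    rw [hℓgap _ (by omega) (by omega)] at hmem
    exact hmem
  have huniv := hprim.rel_of_rel_ne
    (r := fun x y => ∀ w, d ≤ (nbhd Γ x ∩ nbhd Γ w).ncard + ℓ ↔
      d ≤ (nbhd Γ y ∩ nbhd Γ w).ncard + ℓ)
    ⟨fun _ _ => Iff.rfl, fun h w => (h w).symm, fun h h' w => (h w).trans (h' w)⟩
    (fun g hg x y hxy w => by
      have := hxy (g.symm w)
      rwa [← ncard_nbhd_inter_apply hg x, ← ncard_nbhd_inter_apply hg y,
        Equiv.apply_symm_apply] at this)
    hne (fun w => ⟨hstep a b w hab', hstep b a w (by rwa [Set.inter_comm])⟩)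
  refine (huniv v u v).mp ?_
  rw [Set.inter_self, hreg]
  omega

/-- **Inequality (Section 3.2).** With `κ` the smallest positive `i` with `Γ_i ≠ ∅` and
`ℓ = min { i ≥ κ : Γ_{i+1} = ⋯ = Γ_{i+κ} = ∅ }`, if `ℓ ≥ κ + 1` then for every vertex `α`,
`ℓ(ℓ-1) ≥ ∑_{i=1}^{ℓ-1} |Γ_i(α)| (ℓ - i)`. -/
theorem stmt_11 {Ω : Type*} [Fintype Ω] (Γ : Set (Ω × Ω))
    (hprim : VertexPrimitive Γ) (hne : Γ ≠ ∅) (hnu : Γ ≠ Set.univ)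
    (d : ℕ) (hreg : ∀ v : Ω, (nbhd Γ v).ncard = d)
    (κ : ℕ) (hκpos : 0 < κ) (hκne : GammaI Γ d κ ≠ ∅)
    (hκmin : ∀ j : ℕ, 0 < j → j < κ → GammaI Γ d j = ∅)
    (ℓ : ℕ) (hℓκ : κ ≤ ℓ)
    (hℓgap : ∀ j : ℕ, ℓ + 1 ≤ j → j ≤ ℓ + κ → GammaI Γ d j = ∅)
    (hℓmin : ∀ m : ℕ, κ ≤ m → (∀ j : ℕ, m + 1 ≤ j → j ≤ m + κ → GammaI Γ d j = ∅) →
      ℓ ≤ m)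
    (hℓ : κ + 1 ≤ ℓ) :
    ∀ α : Ω, ℓ * (ℓ - 1) ≥ ∑ i ∈ Finset.Icc 1 (ℓ - 1), (nbhd (GammaI Γ d i) α).ncard * (ℓ - i) := by
  intro α
  have hle := hprim.le_ncard_inter_add hreg hκpos (Set.nonempty_iff_ne_empty.mpr hκne) hℓgap
  have hmain := sum_ncard_nbhd_gammaI_mul_le hprim.1 hreg α (hle α)
  have hne : (GammaI Γ d ℓ).Nonempty := by
    rw [Set.nonempty_iff_ne_empty]
    intro hempty
    have := hℓmin (ℓ - 1) (by omega) fun j hj hj' => by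
      rcases Nat.lt_or_ge ℓ j with h | h
      · exact hℓgap j h (by omega)
      · rwa [show j = ℓ by omega]
    omega
  obtain ⟨⟨a, b⟩, hab⟩ := hne
  have hab' : (nbhd Γ a ∩ nbhd Γ b).ncard + ℓ = d := hab
  have hunion := Set.ncard_union_add_ncard_inter (nbhd Γ a) (nbhd Γ b)
  have hcard := Set.ncard_le_card (nbhd Γ a ∪ nbhd Γ b)
  rw [Nat.card_eq_fintype_card] at hcard
  rw [hreg, hreg] at hunion
  obtain ⟨m, rfl⟩ : ∃ m, d = ℓ + m := ⟨d - ℓ, by omega⟩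
  obtain ⟨k, hk⟩ : ∃ k, Fintype.card Ω = ℓ + m + ℓ + k :=
    ⟨Fintype.card Ω - (ℓ + m + ℓ), by omega⟩
  obtain ⟨p, rfl⟩ : ∃ p, ℓ = p + 1 := ⟨ℓ - 1, by omega⟩
  rw [hk] at hmain
  rw [Nat.add_sub_cancel] at hmain ⊢
  nlinarith [Nat.zero_le (m * k)]
end
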